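/- arXiv:1004.3492 — 2 statements merged into one kernel-verified Lean document; each statement's English description precedes it below -/
import Mathlib

section
/- Let W ∈ U(N) be Hermitian with W ≠ I and W ≠ −I. Then there exist anti-Hermitian matrices A, B such that Re Tr(W A²) > 0 and Re Tr(W B²) < 0. Hence every critical point of (1/N)·Re Tr(V†U) on U(N) other than U = ±V is a saddle point. -/
open Matrix

open scoped ComplexOrder in
theorem Matrix.re_trace_conjTranspose_mul_self_pos {m n : Type*} [Fintype m] [Fintype n]
    {M : Matrix m n ℂ} (hM : M ≠ 0) : 0 < (Matrix.trace (Mᴴ * M)).re := by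
  have h : 0 < Matrix.trace (Mᴴ * M) :=
    lt_of_le_of_ne (Matrix.posSemidef_conjTranspose_mul_self M).trace_nonneg
      fun h => hM (Matrix.trace_conjTranspose_mul_self_eq_zero_iff.mp h.symm)
  exact (Complex.pos_iff.mp h).1

/-- A Hermitian unitary `W` with `W ≠ I` and `W ≠ -I` admits anti-Hermitian
directions `A`, `B` with `Re Tr(W A²) > 0` and `Re Tr(W B²) < 0`: every critical
point of `(1/N)·Re Tr(V†U)` other than `U = ±V` is a saddle point. -/
theorem stmt4 {N : ℕ} (W : Matrix (Fin N) (Fin N) ℂ)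
    (hW_herm : Wᴴ = W) (hW_unit : Wᴴ * W = 1)
    (hW1 : W ≠ 1) (hW2 : W ≠ -1) :
    ∃ A B : Matrix (Fin N) (Fin N) ℂ, Aᴴ = -A ∧ Bᴴ = -B ∧
      0 < (Matrix.trace (W * A ^ 2)).re ∧ (Matrix.trace (W * B ^ 2)).re < 0 := by
  have hWW : W * W = 1 := by rwa [hW_herm] at hW_unit
  have hA : W * (Complex.I • (1 - W)) ^ 2 = (1 - W)ᴴ * (1 - W) := by
    rw [smul_pow, Complex.I_sq, pow_two]
    simp only [conjTranspose_sub, conjTranspose_one, hW_herm,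
      mul_sub, sub_mul, mul_one, one_mul, hWW, neg_smul, one_smul, mul_neg]
    abel
  have hB : W * (Complex.I • (1 + W)) ^ 2 = -((1 + W)ᴴ * (1 + W)) := by
    rw [smul_pow, Complex.I_sq, pow_two]
    simp only [conjTranspose_add, conjTranspose_one, hW_herm,
      mul_add, add_mul, mul_one, one_mul, hWW, neg_smul, one_smul, mul_neg]
    abel
  refine ⟨Complex.I • (1 - W), Complex.I • (1 + W), ?_, ?_, ?_, ?_⟩
  · simp [conjTranspose_smul, hW_herm]
  · simp [conjTranspose_smul, hW_herm, add_comm]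
  · rw [hA]
    exact re_trace_conjTranspose_mul_self_pos (sub_ne_zero.mpr hW1.symm)
  · rw [hB, trace_neg, Complex.neg_re, neg_lt_zero]
    refine re_trace_conjTranspose_mul_self_pos fun h => hW2 ?_
    exact eq_neg_of_add_eq_zero_right h
end

section
/- Let W ∈ SU(N) satisfy Re Tr(WA) = 0 for all traceless anti-Hermitian matrices A ∈ su(N). Then W = iα·I + R for some real α and Hermitian matrix R, and every eigenvalue of W equals i·e^{iθ} or i·e^{−iθ} for a single θ ∈ ℝ; i.e., the spectrum of W consists of at most two values that are complex conjugates multiplied by i. -/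
open Matrix

open scoped ComplexOrder in
/-- The anti-Hermitian part of a critical point is a scalar matrix. -/
lemma sub_conjTranspose_eq_smul_one_of_critical {N : ℕ} (W : Matrix (Fin N) (Fin N) ℂ)
    (hcrit : ∀ A : Matrix (Fin N) (Fin N) ℂ, Aᴴ = -A → Matrix.trace A = 0 →
      (Matrix.trace (W * A)).re = 0) :
    ∃ α : ℝ, W - Wᴴ = (2 * (α : ℂ) * Complex.I) • (1 : Matrix (Fin N) (Fin N) ℂ) := by
  rcases Nat.eq_zero_or_pos N with rfl | hN
  · exact ⟨0, Subsingleton.elim _ _⟩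
  have hN' : (N : ℂ) ≠ 0 := by exact_mod_cast hN.ne'
  refine ⟨W.trace.im / N, ?_⟩
  set c : ℂ := 2 * ((W.trace.im / N : ℝ) : ℂ) * Complex.I with hc
  set A : Matrix (Fin N) (Fin N) ℂ := W - Wᴴ - c • 1 with hA
  have hc_star : star c = -c := by
    simp [hc]
  have hA_star : Aᴴ = -A := by
    simp only [hA, conjTranspose_sub, conjTranspose_conjTranspose, conjTranspose_smul,
      conjTranspose_one, hc_star, neg_smul]
    abel
  have hA_trace : A.trace = 0 := by
    rw [hA, trace_sub, trace_sub, trace_smul, trace_one, trace_conjTranspose, Fintype.card_fin, hc,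
      Complex.star_def, Complex.sub_conj]
    push_cast
    rw [smul_eq_mul]
    field_simp
    ring
  have hWA : (Wᴴ * A).trace = -star (W * A).trace := by
    rw [← trace_conjTranspose, conjTranspose_mul, hA_star, neg_mul, trace_neg, neg_neg,
      trace_mul_comm]
  have hre := hcrit A hA_star hA_trace
  have hzero : (Aᴴ * A).trace = 0 := by
    have hAA : A * A = W * A - Wᴴ * A - c • A := by
      conv_lhs => enter [1]; rw [hA]
      rw [sub_mul, sub_mul, smul_mul_assoc, one_mul]
    rw [hA_star, neg_mul, hAA, trace_neg, trace_sub, trace_sub, trace_smul, hA_trace, hWA,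
      Complex.star_def, sub_neg_eq_add, Complex.add_conj, hre]
    simp
  exact sub_eq_zero.mp (trace_conjTranspose_mul_self_eq_zero_iff.mp hzero)

/-- Elements of the spectrum of a complex matrix have eigenvectors. -/
lemma exists_mulVec_eq_smul_of_mem_spectrum {n : Type*} [Fintype n] [DecidableEq n]
    {W : Matrix n n ℂ} {μ : ℂ} (hμ : μ ∈ spectrum ℂ W) :
    ∃ v : n → ℂ, v ≠ 0 ∧ W *ᵥ v = μ • v := by
  rw [spectrum.mem_iff, Matrix.isUnit_iff_isUnit_det, isUnit_iff_ne_zero, not_not] at hμ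
  obtain ⟨v, hv, h⟩ := Matrix.exists_mulVec_eq_zero_iff.mpr hμ
  refine ⟨v, hv, ?_⟩
  rw [Algebra.algebraMap_eq_smul_one, sub_mulVec, smul_mulVec, one_mulVec, sub_eq_zero] at h
  exact h.symm

/-- A complex number on the unit circle with imaginary part `α` is `i·e^{±iθ}` with
`θ = arccos α`. -/
lemma eq_I_mul_exp_arccos_or {μ : ℂ} {α : ℝ} (him : μ.im = α) (hnorm : μ.re ^ 2 + μ.im ^ 2 = 1) :
    μ = Complex.I * Complex.exp (Complex.I * (Real.arccos α : ℝ)) ∨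
      μ = Complex.I * Complex.exp (-(Complex.I * (Real.arccos α : ℝ))) := by
  subst him
  have hcos : Real.cos (Real.arccos μ.im) = μ.im :=
    Real.cos_arccos (by nlinarith [sq_nonneg μ.re]) (by nlinarith [sq_nonneg μ.re])
  have hsin : μ.re ^ 2 = Real.sin (Real.arccos μ.im) ^ 2 := by
    have := Real.sin_sq_add_cos_sq (Real.arccos μ.im)
    rw [hcos] at this
    linarith
  rcases sq_eq_sq_iff_eq_or_eq_neg.mp hsin with h | h
  · right
    apply Complex.ext <;> simp [Complex.exp_re, Complex.exp_im, h, hcos]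
  · left
    apply Complex.ext <;> simp [Complex.exp_re, Complex.exp_im, h, hcos]

/-- If `W ∈ SU(N)` satisfies `Re Tr(WA) = 0` for all traceless anti-Hermitian `A`,
then `W = iα·I + R` with `α` real and `R` Hermitian, and the spectrum of `W`
consists of at most the two values `i·e^{iθ}`, `i·e^{-iθ}` for a single `θ ∈ ℝ`. -/
theorem stmt5 {N : ℕ} (W : Matrix (Fin N) (Fin N) ℂ)
    (hW_unit : Wᴴ * W = 1) (hW_det : W.det = 1)
    (hcrit : ∀ A : Matrix (Fin N) (Fin N) ℂ, Aᴴ = -A → Matrix.trace A = 0 →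
      (Matrix.trace (W * A)).re = 0) :
    (∃ (α : ℝ) (R : Matrix (Fin N) (Fin N) ℂ), Rᴴ = R ∧
      W = ((α : ℂ) * Complex.I) • (1 : Matrix (Fin N) (Fin N) ℂ) + R) ∧
    ∃ θ : ℝ, ∀ μ ∈ spectrum ℂ W,
      μ = Complex.I * Complex.exp (Complex.I * θ) ∨
      μ = Complex.I * Complex.exp (-(Complex.I * θ)) := by
  obtain ⟨α, hα⟩ := sub_conjTranspose_eq_smul_one_of_critical W hcrit
  have hWH : Wᴴ = W - (2 * (α : ℂ) * Complex.I) • (1 : Matrix (Fin N) (Fin N) ℂ) := by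
    rw [← hα, sub_sub_cancel]
  refine ⟨⟨α, W - ((α : ℂ) * Complex.I) • 1, ?_, by abel⟩, Real.arccos α, fun μ hμ => ?_⟩
  · rw [conjTranspose_sub, conjTranspose_smul, conjTranspose_one, hWH, sub_sub, ← add_smul]
    congr 2
    simp
    ring
  obtain ⟨v, hv, hWv⟩ := exists_mulVec_eq_smul_of_mem_spectrum hμ
  have hWHv : Wᴴ *ᵥ v = (μ - 2 * α * Complex.I) • v := by
    rw [hWH, sub_mulVec, smul_mulVec, one_mulVec, hWv, sub_smul]
  have hvv : star v ⬝ᵥ v ≠ 0 := by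
    open scoped ComplexOrder in
    exact dotProduct_star_self_eq_zero.not.mpr hv
  have hconj : star μ = μ - 2 * α * Complex.I := by
    have h : star (W *ᵥ v) ⬝ᵥ v = star v ⬝ᵥ (Wᴴ *ᵥ v) := by
      rw [star_mulVec, dotProduct_mulVec]
    rw [hWv, hWHv, star_smul, smul_dotProduct, dotProduct_smul, smul_eq_mul, smul_eq_mul] at h
    exact mul_right_cancel₀ hvv h
  have hnorm : μ * star μ = 1 := by
    have h : Wᴴ *ᵥ (W *ᵥ v) = v := by rw [mulVec_mulVec, hW_unit, one_mulVec]
    rw [hWv, mulVec_smul, hWHv, ← hconj, smul_smul] at h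
    have h' := congrArg (star v ⬝ᵥ ·) h
    simp only [dotProduct_smul, smul_eq_mul] at h'
    exact mul_right_cancel₀ hvv (h'.trans (one_mul _).symm)
  apply eq_I_mul_exp_arccos_or
  · have := congrArg Complex.im hconj
    simp at this
    linarith
  · have := congrArg Complex.re hnorm
    simp at this
    linarith
end
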